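/- Let x = x_C be the CGHS map x_C(y) = −log(1 + e^{−y}). Let f be a normalized outgoing wave function and suppose there exist constants α > 1/2, C > 0 and L ≥ 1 such that |f(y)| ≤ C/|y|^{1+α} for all y ≤ −L. Then for every β > 0 and every y₀ > 0, |N̄^Th_{β,in}[f_{y₀}] − N̄_o[f_{y₀}]| ≤ C²/(β α² (2α − 1)(y₀/2 + L)^{2α−1}) + (4π/β) e^{L − y₀/2} ∫_0^∞ |f̂(p)|²/(2p(1 − e^{−2πp})) dp. -/

import Mathlib

open MeasureTheory Set Filter
open scoped ENNReal

/-- The Fourier transform `f̂(p) = (2π)^{-1/2} ∫ f(y) e^{-ipy} dy`. -/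
noncomputable def ft (f : ℝ → ℂ) (p : ℝ) : ℂ :=
  (Real.sqrt (2 * Real.pi) : ℂ)⁻¹ *
    ∫ y : ℝ, f y * Complex.exp (-Complex.I * (p : ℂ) * (y : ℂ))

/-- `F̌(k) = (2π)^{-1/2} ∫ f(y) e^{-ik x(y)} dy`. -/
noncomputable def Fk (x : ℝ → ℝ) (f : ℝ → ℂ) (k : ℝ) : ℂ :=
  (Real.sqrt (2 * Real.pi) : ℂ)⁻¹ *
    ∫ y : ℝ, f y * Complex.exp (-Complex.I * (k : ℂ) * (x y : ℂ))

/-- The relativistic black-hole coordinate map `x_R(y) = -e^{-y}`. -/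
noncomputable def xR (y : ℝ) : ℝ := -Real.exp (-y)

/-- The CGHS black-hole coordinate map `x_C(y) = -log(1+e^{-y})`. -/
noncomputable def xC (y : ℝ) : ℝ := -Real.log (1 + Real.exp (-y))

/-- The mean number of spontaneously created particles `N̄_o[f]`. -/
noncomputable def No (x : ℝ → ℝ) (f : ℝ → ℂ) : ℝ≥0∞ :=
  ∫⁻ k in Set.Ioi (0:ℝ), ENNReal.ofReal (‖Fk x f (-k)‖ ^ 2 / (2 * k))

/-- The thermal mean particle number `N̄^Th_β[f]` at inverse temperature `β`. -/
noncomputable def Nth (β : ℝ) (f : ℝ → ℂ) : ℝ≥0∞ :=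
  ∫⁻ p in Set.Ioi (0:ℝ),
    ENNReal.ofReal (‖ft f p‖ ^ 2 / (2 * p * (Real.exp (β * p) - 1)))

/-- translate of `f` by `y₀`. -/
noncomputable def tr (f : ℝ → ℂ) (y₀ : ℝ) : ℝ → ℂ := fun y => f (y - y₀)

/-- The mean number of particles emitted when the incoming state is thermal at inverse
temperature `β`: `N̄^Th_{β,in}[f] = ∫_ℝ |F̌(k)|²/(2k(e^{βk}-1)) dk`. -/
noncomputable def NthIn (x : ℝ → ℝ) (β : ℝ) (f : ℝ → ℂ) : ℝ≥0∞ :=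
  ∫⁻ k : ℝ, ENNReal.ofReal (‖Fk x f k‖ ^ 2 / (2 * k * (Real.exp (β * k) - 1)))


open FourierTransform in
theorem fourier_toLp_ae_eq {f : ℝ → ℂ} (hf : Integrable f) (hf2 : MemLp f 2) :
    (𝓕 (hf2.toLp f) : Lp ℂ 2 (volume : Measure ℝ)) =ᵐ[volume] 𝓕 f := by
  set g := (𝓕 (hf2.toLp f) : Lp ℂ 2 (volume : Measure ℝ)) with hg
  have hgl : LocallyIntegrable g volume :=
    (Lp.memLp g).locallyIntegrable (by norm_num)
  have hcont : Continuous (𝓕 f) :=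
    VectorFourier.fourierIntegral_continuous Real.continuous_fourierChar
      (by fun_prop) hf
  refine ae_eq_of_integral_contDiff_smul_eq hgl hcont.locallyIntegrable fun φ hφ hφs => ?_
  have hφc : ContDiff ℝ (⊤ : ℕ∞) (fun x => (φ x : ℂ)) := Complex.ofRealCLM.contDiff.comp hφ
  have hφcs : HasCompactSupport (fun x => (φ x : ℂ)) :=
    hφs.comp_left (g := fun r : ℝ => (r : ℂ)) (by simp)
  let ψ : SchwartzMap ℝ ℂ := hφcs.toSchwartzMap hφc
  have hψ : ∀ x, ψ x = (φ x : ℂ) := fun x => rfl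
  have h1 : (Lp.toTemperedDistribution g) ψ = ∫ x, φ x • g x := by
    rw [Lp.toTemperedDistribution_apply]
    simp [hψ]
  have h2 : (Lp.toTemperedDistribution g) ψ = ∫ x, (𝓕 ψ) x • f x := by
    rw [hg, ← Lp.fourier_toTemperedDistribution_eq, TemperedDistribution.fourier_apply,
      Lp.toTemperedDistribution_apply]
    refine integral_congr_ae ?_
    filter_upwards [hf2.coeFn_toLp] with x hx
    rw [hx]
  rw [← h1, h2]
  have h3 := VectorFourier.integral_fourierIntegral_smul_eq_flip (μ := volume) (ν := volume)
    (L := innerₗ ℝ) (f := ψ) (g := f)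
    Real.continuous_fourierChar (by fun_prop) ψ.integrable hf
  rw [flip_innerₗ] at h3
  calc _ = _ := h3
    _ = _ := by
      refine integral_congr_ae (Eventually.of_forall fun x => ?_)
      simp only [hψ, smul_eq_mul, Complex.real_smul]
      rfl

theorem lintegral_enorm_sq_eq_eLpNorm (f : ℝ → ℂ) :
    ∫⁻ x, ‖f x‖ₑ ^ 2 = (eLpNorm f 2 volume) ^ 2 := by
  have := eLpNorm_nnreal_pow_eq_lintegral (μ := (volume : Measure ℝ)) (f := f)
    (p := 2) (by norm_num)
  simpa using this.symm

open FourierTransform in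
theorem ft_eq_fourier (f : ℝ → ℂ) (p : ℝ) :
    ft f p = (Real.sqrt (2 * Real.pi) : ℂ)⁻¹ * 𝓕 f ((2 * Real.pi)⁻¹ * p) := by
  rw [ft, Real.fourier_real_eq_integral_exp_smul]
  congr 2
  ext y
  rw [smul_eq_mul, mul_comm]
  congr 2
  push_cast
  field_simp

open FourierTransform in
/-- Plancherel's theorem for `ft` on `L¹ ∩ L²`. -/
theorem lintegral_enorm_ft_sq {f : ℝ → ℂ} (hf : Integrable f) (hf2 : MemLp f 2) :
    ∫⁻ p, ‖ft f p‖ₑ ^ 2 = ∫⁻ y, ‖f y‖ₑ ^ 2 := by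
  have hpi : (0 : ℝ) < 2 * Real.pi := by positivity
  have h1 : ∫⁻ x, ‖𝓕 f x‖ₑ ^ 2 = ∫⁻ y, ‖f y‖ₑ ^ 2 := by
    rw [lintegral_enorm_sq_eq_eLpNorm, lintegral_enorm_sq_eq_eLpNorm,
      ← eLpNorm_congr_ae (fourier_toLp_ae_eq hf hf2), ← Lp.enorm_def, ← Lp.enorm_toLp hf2]
    congr 1
    rw [← ofReal_norm, ← ofReal_norm, Lp.norm_fourier_eq]
  rw [← h1]
  have hm : Measurable (fun x => ‖𝓕 f x‖ₑ ^ 2) := by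
    have hcont : Continuous (𝓕 f) :=
      VectorFourier.fourierIntegral_continuous Real.continuous_fourierChar (by fun_prop) hf
    exact hcont.measurable.enorm.pow_const 2
  have h2 : ∀ p, ‖ft f p‖ₑ ^ 2 =
      ENNReal.ofReal (2 * Real.pi)⁻¹ * ‖𝓕 f ((2 * Real.pi)⁻¹ * p)‖ₑ ^ 2 := by
    intro p
    rw [ft_eq_fourier, enorm_mul, mul_pow]
    congr 1
    rw [← ofReal_norm, ← ENNReal.ofReal_pow (norm_nonneg _)]
    congr 1
    rw [norm_inv, Complex.norm_real, Real.norm_of_nonneg (Real.sqrt_nonneg _), inv_pow,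
      Real.sq_sqrt hpi.le]
  simp_rw [h2]
  rw [lintegral_const_mul' _ _ ENNReal.ofReal_ne_top]
  have h3 := Real.map_volume_mul_left (a := (2 * Real.pi)⁻¹) (by positivity)
  have h4 := lintegral_map (μ := volume) hm (measurable_const_mul (2 * Real.pi)⁻¹)
  rw [← h4, h3, lintegral_smul_measure, inv_inv, abs_of_pos hpi, smul_eq_mul, ← mul_assoc,
    ← ENNReal.ofReal_mul (by positivity), inv_mul_cancel₀ hpi.ne']
  simp

theorem continuous_ft {f : ℝ → ℂ} (hf : Integrable f) : Continuous (ft f) := by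
  have h := VectorFourier.fourierIntegral_continuous (μ := volume) (L := innerₗ ℝ)
    Real.continuous_fourierChar (by fun_prop) hf
  have h2 : ft f = fun p => (Real.sqrt (2 * Real.pi) : ℂ)⁻¹ *
      VectorFourier.fourierIntegral Real.fourierChar volume (innerₗ ℝ) f
        ((2 * Real.pi)⁻¹ * p) := funext fun p => ft_eq_fourier f p
  rw [h2]
  exact continuous_const.mul (h.comp (continuous_const.mul continuous_id))

section Kernel

variable {f : ℝ → ℂ} {K : ℝ → ℝ → ℝ} {M : ℝ≥0∞}

theorem integrable_mul_kernel (hf : Integrable f)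
    (hK : Measurable (Function.uncurry K)) (hM : M ≠ ∞)
    (hKM : ∀ t, ∫⁻ u, ‖K t u‖ₑ ≤ M) :
    Integrable (fun z : ℝ × ℝ => f z.1 * (K z.1 z.2 : ℂ)) (volume.prod volume) := by
  have hKc : Measurable (fun z : ℝ × ℝ => (K z.1 z.2 : ℂ)) :=
    Complex.measurable_ofReal.comp hK
  have hae : AEStronglyMeasurable (fun z : ℝ × ℝ => f z.1 * (K z.1 z.2 : ℂ))
      (volume.prod volume) := hf.1.comp_fst.mul hKc.aestronglyMeasurable
  refine ⟨hae, ?_⟩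
  rw [hasFiniteIntegral_iff_enorm, lintegral_prod _ hae.enorm]
  calc _ = ∫⁻ t, ‖f t‖ₑ * ∫⁻ u, ‖K t u‖ₑ := by
        refine lintegral_congr fun t => ?_
        rw [← lintegral_const_mul' _ _ (by simp)]
        refine lintegral_congr fun u => ?_
        rw [enorm_mul, ← ofReal_norm (K t u : ℂ), Complex.norm_real, ofReal_norm]
    _ ≤ ∫⁻ t, ‖f t‖ₑ * M := lintegral_mono fun t => mul_le_mul_right (hKM t) _
    _ = (∫⁻ t, ‖f t‖ₑ) * M := lintegral_mul_const' _ _ hM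
    _ < ∞ := ENNReal.mul_lt_top hf.2 hM.lt_top

theorem ft_integral_mul_kernel (hf : Integrable f)
    (hK : Measurable (Function.uncurry K)) (hM : M ≠ ∞)
    (hKM : ∀ t, ∫⁻ u, ‖K t u‖ₑ ≤ M) (k : ℝ) :
    ft (fun u => ∫ t, f t * (K t u : ℂ)) k = (Real.sqrt (2 * Real.pi) : ℂ)⁻¹ *
        ∫ t, f t * ∫ u, (K t u : ℂ) * Complex.exp (-Complex.I * (k : ℂ) * (u : ℂ)) := by
  rw [ft]
  congr 1
  have hinteg : Integrable (Function.uncurry fun u t => f t * (K t u : ℂ) *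
      Complex.exp (-Complex.I * (k : ℂ) * (u : ℂ))) (volume.prod volume) := by
    refine (integrable_mul_kernel hf hK hM hKM).swap.mul_bdd (c := 1) ?_
      (Eventually.of_forall fun z => ?_)
    · fun_prop
    · have : -Complex.I * (k : ℂ) * (z.1 : ℂ) = ((-(k * z.1) : ℝ) : ℂ) * Complex.I := by
        push_cast; ring
      rw [this, Complex.norm_exp_ofReal_mul_I]
  calc _ = ∫ u, ∫ t, f t * (K t u : ℂ) * Complex.exp (-Complex.I * (k : ℂ) * (u : ℂ)) := by
        refine integral_congr_ae (Eventually.of_forall fun u => ?_)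
        exact (integral_mul_const _ _).symm
    _ = ∫ t, ∫ u, f t * (K t u : ℂ) * Complex.exp (-Complex.I * (k : ℂ) * (u : ℂ)) :=
        integral_integral_swap hinteg
    _ = _ := by
        refine integral_congr_ae (Eventually.of_forall fun t => ?_)
        simp_rw [mul_assoc]
        exact integral_const_mul _ _

theorem lintegral_enorm_ft_kernel_sq (hf : Integrable f)
    (hK : Measurable (Function.uncurry K)) (hK1 : ∀ t u, ‖K t u‖ ≤ 1) (hM : M ≠ ∞)
    (hKM : ∀ t, ∫⁻ u, ‖K t u‖ₑ ≤ M) :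
    ∫⁻ k : ℝ, ‖ft (fun u => ∫ t, f t * (K t u : ℂ)) k‖ₑ ^ 2 =
      ∫⁻ u, ‖∫ t, f t * (K t u : ℂ)‖ₑ ^ 2 := by
  set H : ℝ → ℂ := fun u => ∫ t, f t * (K t u : ℂ) with hH
  have hHint : Integrable H := (integrable_mul_kernel hf hK hM hKM).integral_prod_right
  have hHb : ∀ u, ‖H u‖ ≤ ∫ t, ‖f t‖ := fun u => by
    refine norm_integral_le_of_norm_le hf.norm (Eventually.of_forall fun t => ?_)
    rw [norm_mul, Complex.norm_real]
    exact mul_le_of_le_one_right (norm_nonneg _) (hK1 t u)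
  refine lintegral_enorm_ft_sq hHint ((memLp_two_iff_integrable_sq_norm hHint.1).2 ?_)
  simp_rw [sq]
  exact hHint.norm.mul_bdd (c := ∫ t, ‖f t‖) hHint.norm.1
    (Eventually.of_forall fun u => by rw [norm_norm]; exact hHb u)

end Kernel

/-- If `f̂(p)/p` is square integrable, so is the primitive of `f` vanishing at `-∞`. -/
theorem lintegral_enorm_primitive_sq_le {f : ℝ → ℂ} (hf : Integrable f) :
    ∫⁻ u, ‖∫ t in Iio u, f t‖ₑ ^ 2 ≤ ∫⁻ p : ℝ, ‖ft f p / p‖ₑ ^ 2 := by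
  set ε : ℕ → ℝ := fun n => 1 / ((n : ℝ) + 1) with hε
  have hε0 : ∀ n, 0 < ε n := fun n => by positivity
  have hεt : Tendsto ε atTop (nhds 0) := tendsto_one_div_add_atTop_nhds_zero_nat
  set κ : ℕ → ℝ → ℝ := fun n s => (Ioi (0:ℝ)).indicator (fun s => Real.exp (-ε n * s)) s with hκ
  have hκm : ∀ n, Measurable (κ n) := fun n =>
    (by fun_prop : Measurable fun s => Real.exp (-ε n * s)).indicator measurableSet_Ioi
  have hκ1 : ∀ n s, ‖κ n s‖ ≤ 1 := fun n s => by
    simp only [hκ, indicator]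
    split_ifs with h
    · rw [Real.norm_of_nonneg (Real.exp_pos _).le, Real.exp_le_one_iff]
      have := mul_pos (hε0 n) h
      linarith
    · simp
  have hκi : ∀ n, Integrable (κ n) := fun n => by
    rw [integrable_indicator_iff measurableSet_Ioi]
    exact integrableOn_exp_mul_Ioi (by simpa using hε0 n) 0
  set K : ℕ → ℝ → ℝ → ℝ := fun n t u => κ n (u - t) with hK
  have hKm : ∀ n, Measurable (Function.uncurry (K n)) := fun n =>
    (hκm n).comp (measurable_snd.sub measurable_fst)
  have hKM : ∀ n t, ∫⁻ u, ‖K n t u‖ₑ ≤ ∫⁻ s, ‖κ n s‖ₑ := fun n t =>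
    (lintegral_sub_right_eq_self (fun s => ‖κ n s‖ₑ) t).le
  have hM : ∀ n, ∫⁻ s, ‖κ n s‖ₑ ≠ ∞ := fun n => (hκi n).2.ne
  have hft : ∀ n (p : ℝ), ft (fun u => ∫ t, f t * (K n t u : ℂ)) p =
      ft f p / (ε n + Complex.I * p) := by
    intro n p
    rw [ft_integral_mul_kernel hf (hKm n) (hM n) (hKM n), ft, mul_div_assoc, ← integral_div]
    congr 2
    ext t
    rw [mul_div_assoc]
    congr 1
    have hre : (-((ε n : ℂ) + Complex.I * p)).re < 0 := by simp [hε0 n]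
    have h1 : ∀ u, (K n t u : ℂ) * Complex.exp (-Complex.I * (p : ℂ) * (u : ℂ)) =
        (Ioi t).indicator (fun u : ℝ => Complex.exp (ε n * t) *
          Complex.exp (-((ε n : ℂ) + Complex.I * p) * u)) u := by
      intro u
      simp only [hK, hκ, indicator, mem_Ioi, sub_pos]
      split_ifs with h
      · push_cast
        rw [← Complex.exp_add, ← Complex.exp_add]
        congr 1
        ring
      · simp
    simp_rw [h1]
    rw [integral_indicator measurableSet_Ioi, integral_const_mul,
      integral_exp_mul_complex_Ioi hre, neg_div_neg_eq, ← mul_div_assoc, ← Complex.exp_add]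
    congr 2
    ring
  have hle : ∀ n, ∫⁻ u, ‖∫ t, f t * (K n t u : ℂ)‖ₑ ^ 2 ≤ ∫⁻ p : ℝ, ‖ft f p / p‖ₑ ^ 2 := by
    intro n
    rw [← lintegral_enorm_ft_kernel_sq hf (hKm n) (fun t u => hκ1 n _) (hM n) (hKM n)]
    refine lintegral_mono_ae ?_
    filter_upwards [compl_mem_ae_iff.2 (measure_singleton (0:ℝ))] with p hp
    have hp : p ≠ 0 := hp
    gcongr ?_ ^ 2
    rw [hft, ← ofReal_norm, ← ofReal_norm]
    apply ENNReal.ofReal_le_ofReal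
    rw [norm_div, norm_div]
    have hp' : 0 < ‖(p : ℂ)‖ := by simpa using hp
    gcongr
    calc ‖(p : ℂ)‖ = |((ε n : ℂ) + Complex.I * p).im| := by simp
      _ ≤ _ := Complex.abs_im_le_norm _
  have hlim : ∀ u, Tendsto (fun n => ‖∫ t, f t * (K n t u : ℂ)‖ₑ ^ 2) atTop
      (nhds (‖∫ t in Iio u, f t‖ₑ ^ 2)) := by
    intro u
    refine ((ENNReal.continuous_pow 2).tendsto _).comp ((continuous_enorm.tendsto _).comp ?_)
    rw [← integral_indicator measurableSet_Iio]
    refine tendsto_integral_of_dominated_convergence (fun t => ‖f t‖) ?_ hf.norm ?_ ?_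
    · intro n
      refine hf.1.mul (Complex.measurable_ofReal.comp ?_).aestronglyMeasurable
      exact (hκm n).comp (measurable_const.sub measurable_id)
    · refine fun n => Eventually.of_forall fun t => ?_
      rw [norm_mul, Complex.norm_real]
      exact mul_le_of_le_one_right (norm_nonneg _) (hκ1 n _)
    · refine Eventually.of_forall fun t => ?_
      simp only [hK, hκ, indicator, mem_Ioi, mem_Iio, sub_pos]
      split_ifs with h
      · have h2 : Tendsto (fun n => f t * ((Real.exp (-ε n * (u - t)) : ℝ) : ℂ)) atTop
            (nhds (f t * ((Real.exp (-0 * (u - t)) : ℝ) : ℂ))) := by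
          refine tendsto_const_nhds.mul ((Complex.continuous_ofReal.tendsto _).comp
            ((Real.continuous_exp.tendsto _).comp (hεt.neg.mul_const _)))
        simpa using h2
      · simp
  calc ∫⁻ u, ‖∫ t in Iio u, f t‖ₑ ^ 2
      = ∫⁻ u, liminf (fun n => ‖∫ t, f t * (K n t u : ℂ)‖ₑ ^ 2) atTop :=
        lintegral_congr fun u => (hlim u).liminf_eq.symm
    _ ≤ liminf (fun n => ∫⁻ u, ‖∫ t, f t * (K n t u : ℂ)‖ₑ ^ 2) atTop :=
        lintegral_liminf_le' fun n =>
          (integrable_mul_kernel hf (hKm n) (hM n) (hKM n)).integral_prod_right.1.enorm.pow_const 2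
    _ ≤ liminf (fun _ : ℕ => ∫⁻ p : ℝ, ‖ft f p / p‖ₑ ^ 2) atTop :=
        liminf_le_liminf (Eventually.of_forall hle)
    _ = _ := liminf_const _

/-- For a map `x` into the negative half line and `f` of mean zero, `F̌(k)/k` is controlled in
`L²` by the primitive of the push-forward of `f` along `x`. -/
theorem lintegral_enorm_Fk_div_sq_le {f : ℝ → ℂ} (hf : Integrable f) (hf0 : ∫ t, f t = 0)
    {x : ℝ → ℝ} (hx : Measurable x) (hx0 : ∀ t, x t < 0) :
    ∫⁻ k : ℝ, ‖Fk x f k / k‖ₑ ^ 2 ≤ ∫⁻ s in Iio 0, ‖∫ t in {t | x t < s}, f t‖ₑ ^ 2 := by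
  set ε : ℕ → ℝ := fun n => 1 / ((n : ℝ) + 1) with hε
  have hε0 : ∀ n, 0 < ε n := fun n => by positivity
  have hεt : Tendsto ε atTop (nhds 0) := tendsto_one_div_add_atTop_nhds_zero_nat
  set κ : ℕ → ℝ → ℝ := fun n s => (Iic (0:ℝ)).indicator (fun s => Real.exp (ε n * s)) s with hκ
  have hκm : ∀ n, Measurable (κ n) := fun n =>
    (by fun_prop : Measurable fun s => Real.exp (ε n * s)).indicator measurableSet_Iic
  have hκ1 : ∀ n s, ‖κ n s‖ ≤ 1 := fun n s => by
    simp only [hκ, indicator]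
    split_ifs with h
    · rw [Real.norm_of_nonneg (Real.exp_pos _).le, Real.exp_le_one_iff]
      exact mul_nonpos_of_nonneg_of_nonpos (hε0 n).le h
    · simp
  have hκi : ∀ n, Integrable (κ n) := fun n => by
    rw [integrable_indicator_iff measurableSet_Iic]
    exact integrableOn_exp_mul_Iic (hε0 n) 0
  set K : ℕ → ℝ → ℝ → ℝ := fun n t s => (Ioi (x t)).indicator (κ n) s with hK
  have hKm : ∀ n, Measurable (Function.uncurry (K n)) := fun n => by
    have : Function.uncurry (K n) = {z : ℝ × ℝ | x z.1 < z.2}.indicator fun z => κ n z.2 := by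
      ext z; simp [hK, Function.uncurry, indicator]
    rw [this]
    exact ((hκm n).comp measurable_snd).indicator
      (measurableSet_lt (hx.comp measurable_fst) measurable_snd)
  have hKκ : ∀ n t s, ‖K n t s‖ ≤ ‖κ n s‖ := fun n t s => norm_indicator_le_norm_self _ _
  have hKM : ∀ n t, ∫⁻ u, ‖K n t u‖ₑ ≤ ∫⁻ s, ‖κ n s‖ₑ := fun n t =>
    lintegral_mono fun s => enorm_le_iff_norm_le.2 (hKκ n t s)
  have hM : ∀ n, ∫⁻ s, ‖κ n s‖ₑ ≠ ∞ := fun n => (hκi n).2.ne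
  have hft : ∀ n (k : ℝ), ft (fun u => ∫ t, f t * (K n t u : ℂ)) k =
      (Real.sqrt (2 * Real.pi) : ℂ)⁻¹ * ∫ t, f t *
        ((1 - Complex.exp ((ε n - Complex.I * k) * x t)) / (ε n - Complex.I * k)) := by
    intro n k
    rw [ft_integral_mul_kernel hf (hKm n) (hM n) (hKM n)]
    congr 2
    ext t
    congr 1
    have hne : (ε n : ℂ) - Complex.I * k ≠ 0 := fun h => by
      have := congrArg Complex.re h
      simp [(hε0 n).ne'] at this
    have h1 : ∀ u, (K n t u : ℂ) * Complex.exp (-Complex.I * (k : ℂ) * (u : ℂ)) =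
        (Ioc (x t) 0).indicator (fun u : ℝ =>
          Complex.exp (((ε n : ℂ) - Complex.I * k) * u)) u := by
      intro u
      simp only [hK, hκ, indicator, mem_Ioi, mem_Iic, mem_Ioc]
      by_cases h : x t < u <;> by_cases h' : u ≤ 0
      · simp only [h, h', and_self, if_true]
        push_cast
        rw [← Complex.exp_add]
        congr 1
        ring
      all_goals simp [h, h']
    simp_rw [h1]
    rw [integral_indicator measurableSet_Ioc, ← intervalIntegral.integral_of_le (hx0 t).le,
      integral_exp_mul_complex hne]
    simp
  have hle : ∀ n, ∫⁻ k, ‖ft (fun u => ∫ t, f t * (K n t u : ℂ)) k‖ₑ ^ 2 ≤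
      ∫⁻ s in Iio 0, ‖∫ t in {t | x t < s}, f t‖ₑ ^ 2 := by
    intro n
    rw [lintegral_enorm_ft_kernel_sq hf (hKm n) (fun t u => (hKκ n t u).trans (hκ1 n _))
      (hM n) (hKM n), setLIntegral_congr Iio_ae_eq_Iic, ← lintegral_indicator measurableSet_Iic]
    refine lintegral_mono fun s => ?_
    have h1 : ∫ t, f t * (K n t s : ℂ) = (∫ t in {t | x t < s}, f t) * κ n s := by
      rw [← integral_indicator (measurableSet_lt hx measurable_const), ← integral_mul_const]
      congr 1
      ext t
      simp only [hK, indicator, mem_Ioi, mem_ofPred_eq]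
      split_ifs <;> simp
    dsimp only
    rw [h1]
    by_cases hs : s ∈ Iic (0:ℝ)
    · rw [indicator_of_mem hs]
      gcongr ?_ ^ 2
      rw [enorm_le_iff_norm_le, norm_mul, Complex.norm_real]
      exact mul_le_of_le_one_right (norm_nonneg _) (hκ1 n s)
    · have : κ n s = 0 := indicator_of_notMem hs _
      simp [this]
  have hlim : ∀ k : ℝ, k ≠ 0 → Tendsto
      (fun n => ‖ft (fun u => ∫ t, f t * (K n t u : ℂ)) k‖ₑ ^ 2) atTop
      (nhds (‖Fk x f k / k‖ₑ ^ 2)) := by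
    intro k hk
    have hI : ∀ t, ‖Complex.exp (-Complex.I * k * x t)‖ = 1 := fun t => by
      have : -Complex.I * (k : ℂ) * (x t : ℂ) = ((-(k * x t) : ℝ) : ℂ) * Complex.I := by
        push_cast; ring
      rw [this, Complex.norm_exp_ofReal_mul_I]
    have hinteg : Integrable fun t => f t * Complex.exp (-Complex.I * k * x t) :=
      hf.mul_bdd (c := 1) (by fun_prop) (Eventually.of_forall fun t => (hI t).le)
    have h0 : ‖Fk x f k / k‖ₑ = ‖(Real.sqrt (2 * Real.pi) : ℂ)⁻¹ * ∫ t, f t *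
        ((1 - Complex.exp (-Complex.I * k * x t)) / (-Complex.I * k))‖ₑ := by
      have : ∫ t, f t * ((1 - Complex.exp (-Complex.I * k * x t)) / (-Complex.I * k)) =
          (∫ t, f t * Complex.exp (-Complex.I * k * x t)) / (Complex.I * k) := by
        have h : ∀ t, f t * ((1 - Complex.exp (-Complex.I * k * x t)) / (-Complex.I * k)) =
            (f t - f t * Complex.exp (-Complex.I * k * x t)) / (-Complex.I * k) := fun t => by ring
        simp_rw [h]
        rw [integral_div, integral_sub hf hinteg, hf0, zero_sub, neg_mul, neg_div_neg_eq]
      rw [this, Fk, ← ofReal_norm, ← ofReal_norm]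
      simp [mul_div_assoc]
    rw [h0]
    simp_rw [hft]
    refine ((ENNReal.continuous_pow 2).tendsto _).comp ((continuous_enorm.tendsto _).comp ?_)
    refine tendsto_const_nhds.mul ?_
    refine tendsto_integral_of_dominated_convergence (fun t => ‖f t‖ * (2 / |k|)) ?_
      (hf.norm.mul_const _) ?_ ?_
    · intro n
      exact hf.1.mul (by fun_prop : Measurable fun t =>
        (1 - Complex.exp ((ε n - Complex.I * k) * x t)) /
          ((ε n : ℂ) - Complex.I * k)).aestronglyMeasurable
    · refine fun n => Eventually.of_forall fun t => ?_
      rw [norm_mul, norm_div]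
      have h1 : ‖Complex.exp ((ε n - Complex.I * k) * x t)‖ ≤ 1 := by
        rw [Complex.norm_exp, Real.exp_le_one_iff]
        simpa using mul_nonpos_of_nonneg_of_nonpos (hε0 n).le (hx0 t).le
      have h2 : ‖1 - Complex.exp ((ε n - Complex.I * k) * x t)‖ ≤ 2 :=
        (norm_sub_le _ _).trans (by rw [norm_one]; linarith)
      have h3 : |k| ≤ ‖(ε n : ℂ) - Complex.I * k‖ := by
        calc |k| = |((ε n : ℂ) - Complex.I * k).im| := by simp
          _ ≤ _ := Complex.abs_im_le_norm _
      have : 0 < |k| := abs_pos.2 hk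
      gcongr
    · refine Eventually.of_forall fun t => ?_
      have hε' : Tendsto (fun n => (ε n : ℂ) - Complex.I * k) atTop
          (nhds (-Complex.I * k)) := by
        have := ((Complex.continuous_ofReal.tendsto _).comp hεt).sub_const (Complex.I * k)
        simpa using this
      refine tendsto_const_nhds.mul (Tendsto.div (tendsto_const_nhds.sub
        ((Complex.continuous_exp.tendsto _).comp (hε'.mul_const _))) hε' ?_)
      simp [hk]
  calc ∫⁻ k : ℝ, ‖Fk x f k / k‖ₑ ^ 2
      = ∫⁻ k, liminf (fun n => ‖ft (fun u => ∫ t, f t * (K n t u : ℂ)) k‖ₑ ^ 2) atTop := by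
        refine lintegral_congr_ae ?_
        filter_upwards [compl_mem_ae_iff.2 (measure_singleton (0:ℝ))] with k hk
        exact (hlim k hk).liminf_eq.symm
    _ ≤ liminf (fun n => ∫⁻ k, ‖ft (fun u => ∫ t, f t * (K n t u : ℂ)) k‖ₑ ^ 2) atTop :=
        lintegral_liminf_le fun n =>
          (continuous_ft (integrable_mul_kernel hf (hKm n) (hM n)
            (hKM n)).integral_prod_right).measurable.enorm.pow_const 2
    _ ≤ liminf (fun _ : ℕ => ∫⁻ s in Iio 0, ‖∫ t in {t | x t < s}, f t‖ₑ ^ 2) atTop :=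
        liminf_le_liminf (Eventually.of_forall hle)
    _ = _ := liminf_const _

theorem integral_eq_zero_of_ft_ae_eq_zero {f : ℝ → ℂ} (hf : Integrable f)
    (hfp : ∀ᵐ p : ℝ, p ≤ 0 → ft f p = 0) : ∫ y, f y = 0 := by
  have h1 : EqOn (ft f) (fun _ => 0) (Icc (-1) 0) := by
    refine Measure.eqOn_Icc_of_ae_eq volume (by norm_num) ?_ (continuous_ft hf).continuousOn
      continuousOn_const
    rw [EventuallyEq, ae_restrict_iff' measurableSet_Icc]
    filter_upwards [hfp] with p hp h using hp h.2
  have h2 : ft f 0 = 0 := h1 (by simp)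
  have hpi : (Real.sqrt (2 * Real.pi) : ℂ) ≠ 0 := by
    rw [Complex.ofReal_ne_zero]; positivity
  rw [ft, mul_eq_zero, or_iff_right (inv_ne_zero hpi)] at h2
  simpa using h2

theorem xC_neg (y : ℝ) : xC y < 0 :=
  neg_neg_of_pos (Real.log_pos (by linarith [Real.exp_pos (-y)]))

theorem hasDerivAt_xC (y : ℝ) : HasDerivAt xC (1 / (1 + Real.exp y)) y := by
  have h0 := Real.exp_pos (-y)
  have h := (((hasDerivAt_neg y).exp.const_add 1).log (by positivity)).neg
  convert! h using 1
  have : Real.exp y * Real.exp (-y) = 1 := by rw [← Real.exp_add]; simp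
  field_simp
  linarith

theorem strictMono_xC : StrictMono xC :=
  strictMono_of_deriv_pos fun y => by
    rw [(hasDerivAt_xC y).deriv]; positivity

theorem range_xC : range xC = Iio 0 := by
  ext x
  refine ⟨?_, fun hx => ?_⟩
  · rintro ⟨y, rfl⟩
    exact xC_neg y
  · have h : 0 < Real.exp (-x) - 1 := by
      rw [sub_pos, Real.one_lt_exp_iff]; linarith [mem_Iio.1 hx]
    refine ⟨-Real.log (Real.exp (-x) - 1), ?_⟩
    rw [xC, neg_neg, Real.exp_log h]
    simp

theorem lintegral_Iio_eq_lintegral_comp_xC (g : ℝ → ℝ≥0∞) :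
    ∫⁻ s in Iio 0, g s = ∫⁻ y, ENNReal.ofReal (1 / (1 + Real.exp y)) * g (xC y) := by
  rw [← range_xC, ← image_univ, lintegral_image_eq_lintegral_abs_deriv_mul MeasurableSet.univ
    (fun y _ => (hasDerivAt_xC y).hasDerivWithinAt) strictMono_xC.injective.injOn,
    Measure.restrict_univ]
  refine lintegral_congr fun y => ?_
  rw [abs_of_pos (by positivity)]

theorem norm_setIntegral_Iio_le {f : ℝ → ℂ} {α C L : ℝ} (hα : 0 < α) (hL : 0 < L)
    (hdecay : ∀ y : ℝ, y ≤ -L → ‖f y‖ ≤ C / |y| ^ (1 + α)) {r : ℝ} (hr : L ≤ r) :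
    ‖∫ t in Iio (-r), f t‖ ≤ C / (α * r ^ α) := by
  have hr0 : 0 < r := hL.trans_le hr
  have h1 : ∫ t in Iio (-r), f t = ∫ t in Ioi r, f (-t) := by
    rw [integral_comp_neg_Ioi, integral_Iic_eq_integral_Iio]
  have hi : IntegrableOn (fun t : ℝ => C * t ^ (-(1 + α))) (Ioi r) :=
    (integrableOn_Ioi_rpow_of_lt (by linarith) hr0).const_mul C
  rw [h1]
  calc ‖∫ t in Ioi r, f (-t)‖ ≤ ∫ t in Ioi r, C * t ^ (-(1 + α)) := by
        refine norm_integral_le_of_norm_le hi ?_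
        rw [ae_restrict_iff' measurableSet_Ioi]
        refine Eventually.of_forall fun t ht => ?_
        have ht : r < t := ht
        have := hdecay (-t) (by linarith)
        rwa [abs_neg, abs_of_pos (hr0.trans ht), div_eq_mul_inv,
          ← Real.rpow_neg (hr0.trans ht).le] at this
    _ = C / (α * r ^ α) := by
        rw [integral_const_mul, integral_Ioi_rpow_of_lt (by linarith) hr0]
        rw [show -(1 + α) + 1 = -α by ring, Real.rpow_neg hr0.le]
        field_simp

theorem lintegral_Iio_enorm_primitive_sq_le {f : ℝ → ℂ} {α C L : ℝ} (hα : 1 / 2 < α)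
    (hL : 0 < L)
    (hdecay : ∀ y : ℝ, y ≤ -L → ‖f y‖ ≤ C / |y| ^ (1 + α)) {r : ℝ} (hr : L ≤ r) :
    ∫⁻ u in Iio (-r), ‖∫ t in Iio u, f t‖ₑ ^ 2 ≤
      ENNReal.ofReal (C ^ 2 / (α ^ 2 * (2 * α - 1) * r ^ (2 * α - 1))) := by
  have hr0 : 0 < r := hL.trans_le hr
  have hi : IntegrableOn (fun t : ℝ => C ^ 2 / α ^ 2 * t ^ (-(2 * α))) (Ioi r) :=
    (integrableOn_Ioi_rpow_of_lt (by linarith) hr0).const_mul _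
  have h1 : ∫⁻ u in Iio (-r), ‖∫ t in Iio u, f t‖ₑ ^ 2 =
      ∫⁻ u in Ioi r, ‖∫ t in Iio (-u), f t‖ₑ ^ 2 := by
    have := (Measure.measurePreserving_neg (volume : Measure ℝ)).setLIntegral_comp_preimage_emb
      (MeasurableEquiv.neg ℝ).measurableEmbedding (fun u => ‖∫ t in Iio u, f t‖ₑ ^ 2) (Iio (-r))
    rw [← this]
    congr 2
    ext u
    simp
  rw [h1]
  calc _ ≤ ∫⁻ u in Ioi r, ENNReal.ofReal (C ^ 2 / α ^ 2 * u ^ (-(2 * α))) := by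
        refine setLIntegral_mono' measurableSet_Ioi fun u hu => ?_
        have hu : r < u := hu
        have hu0 : 0 < u := hr0.trans hu
        rw [← ofReal_norm, ← ENNReal.ofReal_pow (norm_nonneg _)]
        apply ENNReal.ofReal_le_ofReal
        calc _ ≤ (C / (α * u ^ α)) ^ 2 := by
              gcongr
              exact norm_setIntegral_Iio_le (by linarith) hL hdecay (hr.trans hu.le)
          _ = _ := by
              rw [Real.rpow_neg hu0.le, mul_comm 2 α, Real.rpow_mul hu0.le, div_pow, mul_pow]
              rw [Real.rpow_two]
              field_simp
    _ = ENNReal.ofReal (∫ u in Ioi r, C ^ 2 / α ^ 2 * u ^ (-(2 * α))) := by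
        refine (ofReal_integral_eq_lintegral_ofReal hi ?_).symm
        rw [EventuallyLE, ae_restrict_iff' measurableSet_Ioi]
        refine Eventually.of_forall fun u hu => ?_
        have := Real.rpow_nonneg (hr0.trans (mem_Ioi.1 hu)).le (-(2 * α))
        simp only [Pi.zero_apply]
        positivity
    _ = _ := by
        congr 1
        have h2 : (2 * α - 1) ≠ 0 := by linarith
        rw [integral_const_mul, integral_Ioi_rpow_of_lt (by linarith) hr0,
          show -(2 * α) + 1 = -(2 * α - 1) by ring, Real.rpow_neg hr0.le]
        field_simp

theorem lintegral_enorm_Fk_xC_div_sq_le {f : ℝ → ℂ} (hf : Integrable f)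
    (hfp : ∀ᵐ p : ℝ, p ≤ 0 → ft f p = 0)
    {α C L : ℝ} (hα : 1 / 2 < α) (hL : 0 < L)
    (hdecay : ∀ y : ℝ, y ≤ -L → ‖f y‖ ≤ C / |y| ^ (1 + α)) {y₀ : ℝ} (hy₀ : 0 < y₀) :
    ∫⁻ k : ℝ, ‖Fk xC (tr f y₀) k / k‖ₑ ^ 2 ≤
      ENNReal.ofReal (C ^ 2 / (α ^ 2 * (2 * α - 1) * (y₀ / 2 + L) ^ (2 * α - 1))) +
      ENNReal.ofReal (Real.exp (L - y₀ / 2)) * ∫⁻ p in Ioi 0, ‖ft f p / p‖ₑ ^ 2 := by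
  have hf0 : ∫ t, tr f y₀ t = 0 := by
    rw [← integral_eq_zero_of_ft_ae_eq_zero hf hfp]
    exact integral_sub_right_eq_self f y₀
  have hft : Integrable (tr f y₀) := hf.comp_sub_right y₀
  refine (lintegral_enorm_Fk_div_sq_le hft hf0
    strictMono_xC.monotone.measurable xC_neg).trans ?_
  rw [lintegral_Iio_eq_lintegral_comp_xC]
  set h : ℝ → ℝ≥0∞ := fun u => ‖∫ t in Iio u, f t‖ₑ ^ 2 with hh
  have h1 : ∀ y, ‖∫ t in {t | xC t < xC y}, tr f y₀ t‖ₑ ^ 2 = h (y - y₀) := by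
    intro y
    have hs : {t | xC t < xC y} = Iio y := by
      ext t; exact strictMono_xC.lt_iff_lt
    rw [hs, hh]
    dsimp only
    congr 2
    rw [← integral_indicator measurableSet_Iio, ← integral_indicator measurableSet_Iio,
      ← integral_sub_right_eq_self ((Iio (y - y₀)).indicator f) y₀]
    congr 1
    ext t
    simp [indicator, tr]
  rw [lintegral_congr fun y =>
    congrArg (fun z => ENNReal.ofReal (1 / (1 + Real.exp y)) * z) (h1 y)]
  set E : ℝ≥0∞ := ENNReal.ofReal (Real.exp (L - y₀ / 2)) with hE
  set w : ℝ → ℝ≥0∞ := fun u => ENNReal.ofReal (1 / (1 + Real.exp (u + y₀))) * h u with hw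
  have h2 : ∫⁻ y, ENNReal.ofReal (1 / (1 + Real.exp y)) * h (y - y₀) = ∫⁻ u, w u := by
    rw [← lintegral_sub_right_eq_self w y₀]
    simp only [hw, sub_add_cancel]
  rw [h2, ← lintegral_add_compl w (measurableSet_Iio (a := -(y₀ / 2 + L)))]
  refine add_le_add ?_ ?_
  · refine le_trans (lintegral_mono fun u => ?_)
      (lintegral_Iio_enorm_primitive_sq_le hα hL hdecay (r := y₀ / 2 + L) (by linarith))
    refine mul_le_of_le_one_left zero_le ?_
    have he := Real.exp_pos (u + y₀)
    rw [ENNReal.ofReal_le_one, div_le_one (by positivity)]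
    linarith
  · calc ∫⁻ u in (Iio (-(y₀ / 2 + L)))ᶜ, w u
        ≤ ∫⁻ u in (Iio (-(y₀ / 2 + L)))ᶜ, E * h u := by
          refine setLIntegral_mono' measurableSet_Iio.compl fun u hu => ?_
          have hu : -(y₀ / 2 + L) ≤ u := not_lt.1 hu
          refine mul_le_mul_left (ENNReal.ofReal_le_ofReal ?_) _
          calc 1 / (1 + Real.exp (u + y₀)) ≤ 1 / Real.exp (u + y₀) := by
                gcongr; linarith
            _ = Real.exp (-(u + y₀)) := by rw [Real.exp_neg, one_div]
            _ ≤ _ := Real.exp_le_exp.2 (by linarith)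
      _ ≤ ∫⁻ u, E * h u := setLIntegral_le_lintegral _ _
      _ = E * ∫⁻ u, h u := lintegral_const_mul' _ _ ENNReal.ofReal_ne_top
      _ ≤ _ := by
          refine mul_le_mul_right ((lintegral_enorm_primitive_sq_le hf).trans ?_) _
          rw [← lintegral_indicator measurableSet_Ioi]
          refine lintegral_mono_ae ?_
          filter_upwards [hfp] with p hp
          by_cases h0 : p ∈ Ioi 0
          · rw [indicator_of_mem h0]
          · simp [hp (not_lt.1 h0)]

theorem No_eq_lintegral_Iio (x : ℝ → ℝ) (f : ℝ → ℂ) :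
    No x f = ∫⁻ k in Iio (0:ℝ), ENNReal.ofReal (‖Fk x f k‖ ^ 2 / (2 * -k)) := by
  have := (Measure.measurePreserving_neg (volume : Measure ℝ)).setLIntegral_comp_preimage_emb
    (MeasurableEquiv.neg ℝ).measurableEmbedding
    (fun k => ENNReal.ofReal (‖Fk x f k‖ ^ 2 / (2 * -k))) (Iio 0)
  rw [No, ← this]
  simp

theorem No_le_NthIn (x : ℝ → ℝ) (f : ℝ → ℂ) {β : ℝ} (hβ : 0 < β) : No x f ≤ NthIn x β f := by
  rw [No_eq_lintegral_Iio, NthIn]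
  refine (setLIntegral_mono' measurableSet_Iio fun k hk => ?_).trans
    (setLIntegral_le_lintegral (Iio 0) _)
  have hk : k < 0 := hk
  have h1 : Real.exp (β * k) < 1 := by
    rw [Real.exp_lt_one_iff]
    exact mul_neg_of_pos_of_neg hβ hk
  apply ENNReal.ofReal_le_ofReal
  have h2 : 0 < 2 * k * (Real.exp (β * k) - 1) :=
    mul_pos_of_neg_of_neg (by linarith) (by linarith)
  refine div_le_div_of_nonneg_left (sq_nonneg _) h2 ?_
  nlinarith [Real.exp_pos (β * k)]

theorem continuous_Fk {x : ℝ → ℝ} (hx : Measurable x) {f : ℝ → ℂ} (hf : Integrable f) :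
    Continuous (Fk x f) := by
  refine continuous_const.mul (continuous_of_dominated (bound := fun y => ‖f y‖)
    (fun k => hf.1.mul (by fun_prop : Measurable fun y =>
      Complex.exp (-Complex.I * (k : ℂ) * (x y : ℂ))).aestronglyMeasurable)
    (fun k => Eventually.of_forall fun y => ?_) hf.norm
    (Eventually.of_forall fun y => by fun_prop))
  have : -Complex.I * (k : ℂ) * (x y : ℂ) = ((-(k * x y) : ℝ) : ℂ) * Complex.I := by
    push_cast; ring
  rw [norm_mul, this, Complex.norm_exp_ofReal_mul_I, mul_one]

theorem NthIn_le_No_add {x : ℝ → ℝ} (hx : Measurable x) {f : ℝ → ℂ} (hf : Integrable f)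
    {β : ℝ} (hβ : 0 < β) :
    NthIn x β f ≤ No x f + ENNReal.ofReal (1 / (2 * β)) * ∫⁻ k : ℝ, ‖Fk x f k / k‖ₑ ^ 2 := by
  rw [No_eq_lintegral_Iio, NthIn, ← lintegral_const_mul' _ _ ENNReal.ofReal_ne_top,
    ← lintegral_indicator measurableSet_Iio]
  refine le_trans (lintegral_mono fun k => ?_) (lintegral_add_left' ?_ _).le
  · have h1 : ENNReal.ofReal (1 / (2 * β)) * ‖Fk x f k / k‖ₑ ^ 2 =
        ENNReal.ofReal (‖Fk x f k‖ ^ 2 / (2 * β * k ^ 2)) := by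
      rw [← ofReal_norm, ← ENNReal.ofReal_pow (norm_nonneg _), ← ENNReal.ofReal_mul (by positivity)]
      congr 1
      rw [norm_div, Complex.norm_real, Real.norm_eq_abs, div_pow, sq_abs]
      ring
    dsimp only
    rw [h1]
    have hexp := Real.add_one_le_exp (β * k)
    rcases lt_trichotomy k 0 with hk | rfl | hk
    · rw [indicator_of_mem (show k ∈ Iio 0 from hk), ← ENNReal.ofReal_add]
      · apply ENNReal.ofReal_le_ofReal
        have hk2 : k ≠ 0 := hk.ne
        have he : Real.exp (β * k) * Real.exp (-(β * k)) = 1 := by rw [← Real.exp_add]; simp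
        have he2 := Real.add_one_le_exp (-(β * k))
        have h1 : Real.exp (β * k) < 1 := by
          rw [Real.exp_lt_one_iff]
          exact mul_neg_of_pos_of_neg hβ hk
        have h2 : 0 < 2 * k * (Real.exp (β * k) - 1) :=
          mul_pos_of_neg_of_neg (by linarith) (by linarith)
        have h3 : ‖Fk x f k‖ ^ 2 / (2 * -k) + ‖Fk x f k‖ ^ 2 / (2 * β * k ^ 2) =
            ‖Fk x f k‖ ^ 2 * ((1 - β * k) / (2 * β * k ^ 2)) := by
          field_simp
          ring
        rw [h3, div_eq_mul_inv]
        gcongr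
        rw [inv_eq_one_div, div_le_div_iff₀ h2 (by positivity)]
        have h4 : Real.exp (β * k) * (1 - β * k) ≤ 1 := by
          nlinarith [Real.exp_pos (β * k)]
        nlinarith
      · exact div_nonneg (sq_nonneg _) (by linarith)
      · positivity
    · simp
    · rw [indicator_of_notMem (by simpa using hk.le), zero_add]
      apply ENNReal.ofReal_le_ofReal
      have hβk := mul_pos hβ hk
      refine div_le_div_of_nonneg_left (sq_nonneg _) (by positivity) ?_
      nlinarith
  · exact (((((continuous_Fk hx hf).measurable.norm.pow_const 2).div
      (by fun_prop)).ennreal_ofReal).indicator measurableSet_Iio).aemeasurable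

theorem lintegral_enorm_ft_div_sq_le (f : ℝ → ℂ) :
    ∫⁻ p in Ioi 0, ‖ft f p / p‖ₑ ^ 2 ≤ ENNReal.ofReal (4 * Real.pi) *
      ∫⁻ p in Ioi (0:ℝ), ENNReal.ofReal
        (‖ft f p‖ ^ 2 / (2 * p * (1 - Real.exp (-(2 * Real.pi) * p)))) := by
  rw [← lintegral_const_mul' _ _ ENNReal.ofReal_ne_top]
  refine setLIntegral_mono' measurableSet_Ioi fun p hp => ?_
  have hp : 0 < p := hp
  have hpi := Real.pi_pos
  rw [← ofReal_norm, ← ENNReal.ofReal_pow (norm_nonneg _), ← ENNReal.ofReal_mul (by positivity)]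
  apply ENNReal.ofReal_le_ofReal
  have h1 : 0 < 1 - Real.exp (-(2 * Real.pi) * p) := by
    rw [sub_pos, Real.exp_lt_one_iff]
    have : 0 < 2 * Real.pi * p := by positivity
    linarith
  have h2 := Real.add_one_le_exp (-(2 * Real.pi) * p)
  rw [norm_div, Complex.norm_real, Real.norm_of_nonneg hp.le, div_pow, ← mul_div_assoc,
    div_le_div_iff₀ (by positivity) (by positivity)]
  have h3 : 2 * p * (1 - Real.exp (-(2 * Real.pi) * p)) ≤ 4 * Real.pi * p ^ 2 := by nlinarith
  nlinarith [mul_le_mul_of_nonneg_left h3 (sq_nonneg ‖ft f p‖)]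

/-- For the CGHS map and a normalized outgoing wave function `f` with
`|f(y)| ≤ C/|y|^{1+α}` for `y ≤ -L` (`α > 1/2`, `C > 0`, `L ≥ 1`), for every `β > 0`
and `y₀ > 0`, `|N̄^Th_{β,in}[f_{y₀}] - N̄_o[f_{y₀}]|
  ≤ C²/(βα²(2α-1)(y₀/2+L)^{2α-1}) + (4π/β) e^{L-y₀/2} ∫_0^∞ |f̂(p)|²/(2p(1-e^{-2πp})) dp`. -/
theorem stmt_19 (f : ℝ → ℂ) (hf : MeasureTheory.Integrable f)
    (hfp : ∀ᵐ p : ℝ, p ≤ 0 → ft f p = 0)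
    (hfn : (∫⁻ p in Set.Ioi (0:ℝ),
        ENNReal.ofReal (‖ft f p‖ ^ 2 / (2 * p))) = 1)
    (α C L : ℝ) (hα : 1/2 < α) (hC : 0 < C) (hL : 1 ≤ L)
    (hdecay : ∀ y : ℝ, y ≤ -L → ‖f y‖ ≤ C / |y| ^ (1 + α))
    (β : ℝ) (hβ : 0 < β) (y₀ : ℝ) (hy₀ : 0 < y₀) :
    NthIn xC β (tr f y₀) - No xC (tr f y₀) ≤
      ENNReal.ofReal (C ^ 2 /
          (β * α ^ 2 * (2 * α - 1) * (y₀ / 2 + L) ^ (2 * α - 1))) +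
        ENNReal.ofReal (4 * Real.pi / β * Real.exp (L - y₀ / 2)) *
          ∫⁻ p in Set.Ioi (0:ℝ), ENNReal.ofReal
            (‖ft f p‖ ^ 2 / (2 * p * (1 - Real.exp (-(2 * Real.pi) * p)))) ∧
    No xC (tr f y₀) - NthIn xC β (tr f y₀) ≤
      ENNReal.ofReal (C ^ 2 /
          (β * α ^ 2 * (2 * α - 1) * (y₀ / 2 + L) ^ (2 * α - 1))) +
        ENNReal.ofReal (4 * Real.pi / β * Real.exp (L - y₀ / 2)) *
          ∫⁻ p in Set.Ioi (0:ℝ), ENNReal.ofReal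
            (‖ft f p‖ ^ 2 / (2 * p * (1 - Real.exp (-(2 * Real.pi) * p)))) := by
  have hL0 : 0 < L := by linarith
  have hα1 : 0 < 2 * α - 1 := by linarith
  have hα0 : 0 < α := by linarith
  refine ⟨?_, ?_⟩
  · rw [tsub_le_iff_left]
    refine (NthIn_le_No_add strictMono_xC.monotone.measurable (hf.comp_sub_right y₀) hβ).trans
      (add_le_add_right ?_ _)
    refine (mul_le_mul_right
      (lintegral_enorm_Fk_xC_div_sq_le hf hfp hα hL0 hdecay hy₀) _).trans ?_
    rw [mul_add, ← ENNReal.ofReal_mul (by positivity), ← mul_assoc,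
      ← ENNReal.ofReal_mul (by positivity)]
    have hβ2 : 1 / (2 * β) ≤ 1 / β := by
      gcongr
      linarith
    refine add_le_add (ENNReal.ofReal_le_ofReal ?_) ?_
    · calc _ ≤ 1 / β * (C ^ 2 / (α ^ 2 * (2 * α - 1) * (y₀ / 2 + L) ^ (2 * α - 1))) := by
            gcongr
        _ = _ := by rw [div_mul_div_comm, one_mul]; simp only [mul_assoc]
    · refine (mul_le_mul_right (lintegral_enorm_ft_div_sq_le f) _).trans ?_
      rw [← mul_assoc, ← ENNReal.ofReal_mul (by positivity)]
      refine mul_le_mul_left (ENNReal.ofReal_le_ofReal ?_) _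
      calc _ ≤ 1 / β * Real.exp (L - y₀ / 2) * (4 * Real.pi) := by gcongr
        _ = _ := by ring
  · rw [tsub_eq_zero_of_le (No_le_NthIn xC (tr f y₀) hβ)]
    exact zero_le
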